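/- arXiv:1904.02002 — 3 statements merged into one kernel-verified Lean document; each statement's English description precedes it below -/
import Mathlib

section
/- Let d ≥ 1, let G be a group, and let ρ : G →* GL(Fin d, ℝ) be a homomorphism into the invertible d×d real matrices. Let S ⊆ H be a nonempty connected subset whose linear span is all of ℝ^d, and assume S is projectively invariant under ρ: for every g ∈ G and x ∈ S, ((ρ g).mulVec x) 0 ≠ 0 and (((ρ g).mulVec x) 0)⁻¹ • ((ρ g).mulVec x) ∈ S. Then the convex hull C = convexHull ℝ S is contained in H and satisfies: (i) C is projectively invariant under ρ, i.e. for every g ∈ G and y ∈ C, ((ρ g).mulVec y) 0 ≠ 0 and (((ρ g).mulVec y) 0)⁻¹ • ((ρ g).mulVec y) ∈ C; and (ii) C has nonempty interior relative to H: there exist y ∈ C and ε > 0 such that every z ∈ H with dist z y < ε lies in C. (This is the chart form of Proposition 3.2: a group admitting a connected, spanning, projectively invariant set in an affine chart preserves a properly convex domain.) -/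
/-- If a linear functional `l` is positive on `S` and `x ↦ (l x)⁻¹ • A x` maps `S` into the
convex set `C`, then the same holds on the convex hull of `S`. -/
theorem pos_and_inv_smul_mem_of_mem_convexHull {E F : Type*} [AddCommGroup E] [Module ℝ E]
    [AddCommGroup F] [Module ℝ F] {S : Set E} {C : Set F} (hC : Convex ℝ C)
    (A : E →ₗ[ℝ] F) (l : E →ₗ[ℝ] ℝ) (h : ∀ x ∈ S, 0 < l x ∧ (l x)⁻¹ • A x ∈ C)
    {y : E} (hy : y ∈ convexHull ℝ S) : 0 < l y ∧ (l y)⁻¹ • A y ∈ C := by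
  refine convexHull_min (t := {y | 0 < l y ∧ (l y)⁻¹ • A y ∈ C}) h ?_ hy
  rintro a ⟨ha, ha'⟩ b ⟨hb, hb'⟩ s t hs ht hst
  have hpos : 0 < s * l a + t * l b := by
    rcases hs.eq_or_lt with rfl | hs
    · obtain rfl : t = 1 := by linarith
      simpa using hb
    · positivity
  have hl : l (s • a + t • b) = s * l a + t * l b := by simp
  refine ⟨hl ▸ hpos, ?_⟩
  rw [hl]
  convert hC ha' hb' (a := s * l a / (s * l a + t * l b)) (b := t * l b / (s * l a + t * l b))
    (by positivity) (by positivity) (by field_simp) using 1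
  rw [map_add, map_smul, map_smul, smul_add, smul_smul, smul_smul, smul_smul, smul_smul]
  congr 2 <;> field_simp

/-- A continuous real function without zeros on a preconnected set has constant sign there. -/
theorem IsPreconnected.forall_pos_or_forall_neg {X : Type*} [TopologicalSpace X] {S : Set X}
    (hS : IsPreconnected S) {f : X → ℝ} (hf : ContinuousOn f S) (h : ∀ x ∈ S, f x ≠ 0) :
    (∀ x ∈ S, 0 < f x) ∨ ∀ x ∈ S, f x < 0 := by
  by_contra! ⟨⟨a, ha, hfa⟩, b, hb, hfb⟩
  obtain ⟨c, hc, hfc⟩ := hS.intermediate_value ha hb hf ⟨hfa, hfb⟩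
  exact h c hc hfc

/-- A point of the linear span of `S` on which a functional equal to `1` on `S` takes the value `1`
lies in the affine span of `S`. -/
theorem mem_affineSpan_of_mem_span {k E : Type*} [Ring k] [AddCommGroup E] [Module k E]
    {S : Set E} (l : E →ₗ[k] k) (hS : ∀ x ∈ S, l x = 1) (hne : S.Nonempty) {z : E}
    (hz : z ∈ Submodule.span k S) (hlz : l z = 1) : z ∈ affineSpan k S := by
  obtain ⟨s, hs⟩ := hne
  have key : z - l z • s ∈ (affineSpan k S).direction := by
    clear hlz
    induction hz using Submodule.span_induction with
    | mem x hx =>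
      rw [hS x hx, one_smul]
      exact AffineSubspace.vsub_mem_direction (subset_affineSpan k S hx) (subset_affineSpan k S hs)
    | zero => simp
    | add x y _ _ hx hy =>
      convert add_mem hx hy using 1
      rw [map_add, add_smul]
      abel
    | smul a x _ hx =>
      convert Submodule.smul_mem _ a hx using 1
      rw [map_smul, smul_sub, smul_smul, smul_eq_mul]
  rw [hlz, one_smul] at key
  simpa using AffineSubspace.vadd_mem_of_mem_direction key (subset_affineSpan k S hs)


/-- Chart form of Proposition 3.2: a group admitting a connected, spanning,
projectively invariant set in the affine chart `H = {x | x ⟨0, hd⟩ = 1}` preserves a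
properly convex domain: the convex hull of that set is contained in the chart,
is projectively invariant, and has nonempty interior relative to the chart. -/
theorem stmt0 (d : ℕ) (hd : 1 ≤ d) (G : Type*) [Group G]
    (ρ : G →* GL (Fin d) ℝ)
    (S : Set (Fin d → ℝ)) (hSH : S ⊆ {x : Fin d → ℝ | x ⟨0, hd⟩ = 1})
    (hne : S.Nonempty) (hconn : IsConnected S)
    (hspan : Submodule.span ℝ S = ⊤)
    (hinv : ∀ g : G, ∀ x ∈ S,
      ((ρ g : Matrix (Fin d) (Fin d) ℝ).mulVec x) ⟨0, hd⟩ ≠ 0 ∧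
      (((ρ g : Matrix (Fin d) (Fin d) ℝ).mulVec x) ⟨0, hd⟩)⁻¹ •
        ((ρ g : Matrix (Fin d) (Fin d) ℝ).mulVec x) ∈ S) :
    convexHull ℝ S ⊆ {x : Fin d → ℝ | x ⟨0, hd⟩ = 1} ∧
    (∀ g : G, ∀ y ∈ convexHull ℝ S,
      ((ρ g : Matrix (Fin d) (Fin d) ℝ).mulVec y) ⟨0, hd⟩ ≠ 0 ∧
      (((ρ g : Matrix (Fin d) (Fin d) ℝ).mulVec y) ⟨0, hd⟩)⁻¹ •
        ((ρ g : Matrix (Fin d) (Fin d) ℝ).mulVec y) ∈ convexHull ℝ S) ∧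
    (∃ y ∈ convexHull ℝ S, ∃ ε > 0, ∀ z ∈ {x : Fin d → ℝ | x ⟨0, hd⟩ = 1},
      dist z y < ε → z ∈ convexHull ℝ S) := by
  let l : (Fin d → ℝ) →ₗ[ℝ] ℝ := LinearMap.proj ⟨0, hd⟩
  refine ⟨convexHull_min hSH (convex_hyperplane l.isLinear 1), fun g y hy => ?_, ?_⟩
  · let A : (Fin d → ℝ) →ₗ[ℝ] (Fin d → ℝ) := (ρ g : Matrix (Fin d) (Fin d) ℝ).mulVecLin
    change (l ∘ₗ A) y ≠ 0 ∧ ((l ∘ₗ A) y)⁻¹ • A y ∈ convexHull ℝ S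
    replace hinv : ∀ x ∈ S, (l ∘ₗ A) x ≠ 0 ∧ ((l ∘ₗ A) x)⁻¹ • A x ∈ S := hinv g
    rcases hconn.isPreconnected.forall_pos_or_forall_neg
      (LinearMap.continuous_of_finiteDimensional (l ∘ₗ A)).continuousOn
      (fun x hx => (hinv x hx).1) with h | h
    · have := pos_and_inv_smul_mem_of_mem_convexHull (convex_convexHull ℝ S) A (l ∘ₗ A)
        (fun x hx => ⟨h x hx, subset_convexHull ℝ S (hinv x hx).2⟩) hy
      exact ⟨this.1.ne', this.2⟩
    · have := pos_and_inv_smul_mem_of_mem_convexHull (convex_convexHull ℝ S) (-A) (-(l ∘ₗ A))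
        (fun x hx => ⟨neg_pos.2 (h x hx), by
          simpa only [LinearMap.neg_apply, inv_neg, neg_smul_neg]
            using subset_convexHull ℝ S (hinv x hx).2⟩) hy
      simp only [LinearMap.neg_apply, inv_neg, neg_smul_neg] at this
      exact ⟨(neg_pos.1 this.1).ne, this.2⟩
  · obtain ⟨_, y, hy, rfl⟩ := hne.convexHull.intrinsicInterior (convex_convexHull ℝ S)
    obtain ⟨ε, hε, hball⟩ := Metric.mem_nhds_iff.1 (mem_interior_iff_mem_nhds.1 hy)
    have hyC : (y : Fin d → ℝ) ∈ convexHull ℝ S := by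
      simpa using interior_subset hy
    refine ⟨y, hyC, ε, hε, fun z hz hzy => ?_⟩
    have hz' : z ∈ affineSpan ℝ (convexHull ℝ S) := by
      rw [affineSpan_convexHull]
      exact mem_affineSpan_of_mem_span l hSH hne (hspan ▸ Submodule.mem_top) hz
    exact @hball ⟨z, hz'⟩ hzy
end

section
/- Let r ≥ 1 and let k : Fin r → ℕ with every k s ≥ 1, q : Fin r → ℂ, and suppose ‖q 0‖ ≥ ‖q s‖ for all s, that k s ≤ k 0 whenever ‖q s‖ = ‖q 0‖, and that q 0 ≠ 0. Let D be the block diagonal matrix (Matrix.blockDiagonal') whose s-th diagonal block is the Jordan block J(q s, k s), let P be an invertible square complex matrix of the same size, and set A = P * D * P⁻¹. Then there exist a constant C ≥ 1 and N ∈ ℕ such that for all n ≥ N: (1/C) · (n.choose (k 0 − 1)) · ‖q 0‖^(n − (k 0 − 1)) ≤ ‖A^n‖ ≤ C · (n.choose (k 0 − 1)) · ‖q 0‖^(n − (k 0 − 1)). (This is the growth estimate for powers of a matrix in Jordan normal form used in the proof of Lemma 8.3.) -/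
/-- The `k × k` Jordan block with the value `q` along the diagonal. -/
def jordanBlock (q : ℂ) (k : ℕ) : Matrix (Fin k) (Fin k) ℂ :=
  Matrix.of fun i j : Fin k =>
    if (j : ℕ) = (i : ℕ) then q else if (j : ℕ) = (i : ℕ) + 1 then 1 else 0

attribute [local instance] Matrix.normedAddCommGroup

open Asymptotics Filter

theorem jordanBlock_pow_apply (q : ℂ) (k n : ℕ) (i j : Fin k) :
    (jordanBlock q k ^ n) i j =
      if (i : ℕ) ≤ j then
        (n.choose ((j : ℕ) - i) : ℂ) * q ^ (n - ((j : ℕ) - i))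
      else 0 := by
  induction n generalizing i j with
  | zero =>
    rw [pow_zero, Matrix.one_apply]
    by_cases h : i = j
    · simp [h]
    · have h' : (i : ℕ) ≠ j := fun e => h (Fin.ext e)
      rw [if_neg h]
      split_ifs with hij
      · rw [Nat.choose_eq_zero_of_lt (by omega)]
        simp
      · rfl
  | succ n ih =>
    set f : ℕ → ℂ := fun l => if l ≤ (j : ℕ) then
      (n.choose ((j : ℕ) - l) : ℂ) * q ^ (n - ((j : ℕ) - l)) else 0 with hf
    have hsum : (jordanBlock q k ^ (n + 1)) i j = q * f i + f (i + 1) := by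
      rw [pow_succ', Matrix.mul_apply]
      have h₁ : ∀ l : Fin k, jordanBlock q k i l * (jordanBlock q k ^ n) l j =
          (fun l : ℕ => (if l = (i : ℕ) then q * f i else 0) +
            if l = (i : ℕ) + 1 then f (i + 1) else 0) l := by
        intro l
        rw [ih l j]
        simp only [jordanBlock, Matrix.of_apply, hf]
        by_cases h : (l : ℕ) = i
        · simp [h]
        · by_cases h' : (l : ℕ) = i + 1
          · simp [h']
          · simp [h, h']
      rw [Finset.sum_congr rfl fun l _ => h₁ l,
        Fin.sum_univ_eq_sum_range (fun l : ℕ => (if l = (i : ℕ) then q * f i else 0) +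
            if l = (i : ℕ) + 1 then f (i + 1) else 0) k,
        Finset.sum_add_distrib, Finset.sum_ite_eq', Finset.sum_ite_eq',
        if_pos (Finset.mem_range.2 i.2)]
      split_ifs with h
      · rfl
      · have : ¬ ((i : ℕ) + 1 ≤ j) := by
          have := j.2
          rw [Finset.mem_range] at h
          omega
        simp [hf, this]
    rw [hsum]
    simp only [hf]
    rcases lt_trichotomy (i : ℕ) j with h | h | h
    · obtain ⟨d, hd⟩ := Nat.exists_eq_add_of_lt h
      have e₁ : (j : ℕ) - i = d + 1 := by omega
      have e₂ : (j : ℕ) - (i + 1) = d := by omega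
      rw [if_pos h.le, if_pos (by omega), if_pos h.le, e₁, e₂, Nat.choose_succ_succ,
        Nat.add_sub_add_right]
      push_cast
      rcases lt_or_ge n (d + 1) with hn | hn
      · rw [Nat.choose_eq_zero_of_lt hn]
        simp
      · rw [show n - d = n - (d + 1) + 1 by omega, pow_succ]
        ring
    · simp [h, pow_succ']
    · rw [if_neg (by omega), if_neg (by omega), if_neg (by omega)]
      simp

theorem pow_isBigO_choose_mul_pow {Q : ℝ} (hQ : 0 < Q) (m : ℕ) :
    (fun n : ℕ => Q ^ n) =O[atTop] fun n : ℕ => (n.choose m : ℝ) * Q ^ (n - m) := by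
  refine IsBigO.of_bound (Q ^ m) ?_
  filter_upwards [eventually_ge_atTop m] with n hn
  have h₁ : (1 : ℝ) ≤ n.choose m := by exact_mod_cast Nat.choose_pos hn
  rw [Real.norm_of_nonneg (by positivity), Real.norm_of_nonneg (by positivity)]
  calc Q ^ n = Q ^ m * (1 * Q ^ (n - m)) := by rw [one_mul, ← pow_add]; congr 1; omega
    _ ≤ _ := by gcongr

theorem choose_mul_pow_isBigO_of_le {Q : ℝ} (hQ : 0 < Q) {d m : ℕ} (hdm : d ≤ m) :
    (fun n : ℕ => (n.choose d : ℝ) * Q ^ (n - d)) =O[atTop]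
      fun n : ℕ => (n.choose m : ℝ) * Q ^ (n - m) := by
  refine IsBigO.of_bound (Q ^ (m - d)) ?_
  filter_upwards [eventually_ge_atTop (2 * m)] with n hn
  have h₁ : (n.choose d : ℝ) ≤ n.choose m := by
    exact_mod_cast Nat.le_induction (P := fun l _ => l ≤ m → n.choose d ≤ n.choose l)
      (fun _ => le_rfl) (fun l _ ih hl => (ih (by omega)).trans
        (Nat.choose_le_succ_of_lt_half_left (by omega))) m hdm le_rfl
  rw [Real.norm_of_nonneg (by positivity), Real.norm_of_nonneg (by positivity)]
  calc (n.choose d : ℝ) * Q ^ (n - d) = Q ^ (m - d) * (n.choose d * Q ^ (n - m)) := by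
        rw [show n - d = (m - d) + (n - m) by omega, pow_add]; ring
    _ ≤ _ := by gcongr

theorem choose_mul_pow_isBigO_of_lt {a Q : ℝ} (ha : 0 ≤ a) (haQ : a < Q) (d : ℕ) :
    (fun n : ℕ => (n.choose d : ℝ) * a ^ (n - d)) =O[atTop] fun n : ℕ => Q ^ n := by
  obtain ⟨b, hab, hbQ⟩ := exists_between haQ
  have hb : 0 < b := ha.trans_lt hab
  refine IsBigO.trans (g := fun n : ℕ => (n : ℝ) ^ d * b ^ n) ?_
    (isLittleO_pow_const_mul_const_pow_const_pow_of_norm_lt d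
      (by rwa [Real.norm_of_nonneg hb.le])).isBigO
  refine IsBigO.of_bound ((b ^ d)⁻¹) ?_
  filter_upwards [eventually_ge_atTop d] with n hn
  have h₁ : (n.choose d : ℝ) ≤ (n : ℝ) ^ d := by exact_mod_cast Nat.choose_le_pow n d
  rw [Real.norm_of_nonneg (by positivity), Real.norm_of_nonneg (by positivity)]
  calc (n.choose d : ℝ) * a ^ (n - d) ≤ (n : ℝ) ^ d * b ^ (n - d) := by gcongr
    _ = _ := by
      rw [pow_sub₀ b hb.ne' hn]; ring

theorem Matrix.isBigO_mul_mul {ι : Type*} [Fintype ι] {g : ℕ → ℝ}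
    {M : ℕ → Matrix ι ι ℂ} (hM : ∀ i j, (fun n => M n i j) =O[atTop] g)
    (X Y : Matrix ι ι ℂ) (i j : ι) :
    (fun n => (X * M n * Y) i j) =O[atTop] g := by
  simp only [Matrix.mul_apply, Finset.sum_mul]
  refine IsBigO.fun_sum fun a _ => IsBigO.fun_sum fun b _ => ?_
  refine ((hM b a).const_mul_left (X i b * Y a j)).congr_left fun n => ?_
  ring

/-- Growth estimate for powers of a matrix in Jordan normal form (used in the
proof of Lemma 8.3): if the dominant Jordan block is `J(q 0, k 0)`, then
`‖A^n‖` grows like `C(n, k 0 - 1) ‖q 0‖^(n - (k 0 - 1))`, where `‖·‖` denotes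
the entrywise supremum norm. -/
theorem stmt4 (r : ℕ) (hr : 1 ≤ r) (k : Fin r → ℕ) (hk : ∀ s, 1 ≤ k s)
    (q : Fin r → ℂ)
    (hq : ∀ s, ‖q s‖ ≤ ‖q ⟨0, hr⟩‖)
    (hkmax : ∀ s, ‖q s‖ = ‖q ⟨0, hr⟩‖ → k s ≤ k ⟨0, hr⟩)
    (hq0 : q ⟨0, hr⟩ ≠ 0)
    (P : Matrix ((s : Fin r) × Fin (k s)) ((s : Fin r) × Fin (k s)) ℂ)
    (hP : IsUnit P.det)
    (A : Matrix ((s : Fin r) × Fin (k s)) ((s : Fin r) × Fin (k s)) ℂ)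
    (hA : A = P * Matrix.blockDiagonal' (fun s => jordanBlock (q s) (k s)) * P⁻¹) :
    ∃ C : ℝ, 1 ≤ C ∧ ∃ N : ℕ, ∀ n ≥ N,
      (1 / C) * (n.choose (k ⟨0, hr⟩ - 1)) *
          ‖q ⟨0, hr⟩‖ ^ (n - (k ⟨0, hr⟩ - 1)) ≤ ‖A ^ n‖ ∧
      ‖A ^ n‖ ≤ C * (n.choose (k ⟨0, hr⟩ - 1)) *
          ‖q ⟨0, hr⟩‖ ^ (n - (k ⟨0, hr⟩ - 1)) := by
  set D := Matrix.blockDiagonal' (fun s => jordanBlock (q s) (k s)) with hD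
  set s₀ : Fin r := ⟨0, hr⟩
  set m := k s₀ - 1
  set Q := ‖q s₀‖
  have hQ : 0 < Q := norm_pos_iff.2 hq0
  set f : ℕ → ℝ := fun n => (n.choose m : ℝ) * Q ^ (n - m)
  have hf : ∀ n, 0 ≤ f n := fun n => by positivity
  have hDn : ∀ n, D ^ n = Matrix.blockDiagonal' (fun s => jordanBlock (q s) (k s) ^ n) :=
    fun n => (Matrix.blockDiagonal'_pow _ n).symm
  have hAn : ∀ n, A ^ n = P * D ^ n * P⁻¹ := by
    intro n
    induction n with
    | zero => simp [Matrix.mul_nonsing_inv P hP]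
    | succ n ih =>
      rw [pow_succ, ih, hA, pow_succ]
      simp only [Matrix.mul_assoc, Matrix.nonsing_inv_mul_cancel_left _ _ hP]
  have hDA : ∀ n, D ^ n = P⁻¹ * A ^ n * P := by
    intro n
    rw [hAn]
    simp only [Matrix.mul_assoc, Matrix.nonsing_inv_mul_cancel_left _ _ hP,
      Matrix.nonsing_inv_mul _ hP, Matrix.mul_one]
  have hDf : ∀ x y, (fun n => (D ^ n) x y) =O[atTop] f := by
    rintro ⟨s, i⟩ ⟨t, j⟩
    simp only [hDn]
    by_cases hst : s = t
    · subst hst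
      simp only [Matrix.blockDiagonal'_apply_eq, jordanBlock_pow_apply]
      split_ifs with hij
      · have hnorm : (fun n : ℕ => (n.choose ((j : ℕ) - i) : ℝ) *
            ‖q s‖ ^ (n - ((j : ℕ) - i))) =O[atTop] f := by
          rcases (hq s).lt_or_eq with h | h
          · exact (choose_mul_pow_isBigO_of_lt (norm_nonneg _) h _).trans
              (pow_isBigO_choose_mul_pow hQ m)
          · rw [h]
            refine choose_mul_pow_isBigO_of_le hQ ?_
            have := hkmax s h
            have := j.2
            omega
        refine IsBigO.of_norm_left (hnorm.congr_left fun n => ?_)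
        simp
      · exact isBigO_zero _ _
    · simp only [Matrix.blockDiagonal'_apply_ne _ _ _ hst]
      exact isBigO_zero _ _
  have hupper : (fun n => A ^ n) =O[atTop] f := by
    refine isBigO_pi.2 fun x => isBigO_pi.2 fun y => ?_
    simp only [hAn]
    exact Matrix.isBigO_mul_mul hDf P P⁻¹ x y
  have hlower : f =O[atTop] fun n => ‖A ^ n‖ := by
    have hk₀ := hk s₀
    have h₁ := Matrix.isBigO_mul_mul (M := fun n => A ^ n) (g := fun n => ‖A ^ n‖)
      (fun i j => IsBigO.of_bound 1 (Eventually.of_forall fun n => by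
        simpa using Matrix.norm_entry_le_entrywise_sup_norm (A ^ n))) P⁻¹ P
      ⟨s₀, ⟨0, by omega⟩⟩ ⟨s₀, ⟨m, by omega⟩⟩
    refine (h₁.norm_left).congr_left fun n => ?_
    rw [← hDA, hDn, Matrix.blockDiagonal'_apply_eq, jordanBlock_pow_apply]
    simp [f, Q]
  obtain ⟨c₁, h₁⟩ := hupper.bound
  obtain ⟨c₂, h₂⟩ := hlower.bound
  obtain ⟨N, hN⟩ := eventually_atTop.1 (h₁.and h₂)
  have hC : (1 : ℝ) ≤ max 1 (max c₁ c₂) := le_max_left _ _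
  refine ⟨max 1 (max c₁ c₂), hC, N, fun n hn => ?_⟩
  obtain ⟨hu, hl⟩ := hN n hn
  rw [Real.norm_of_nonneg (hf n)] at hu hl
  rw [norm_norm] at hl
  rw [mul_assoc, mul_assoc]
  constructor
  · rw [one_div, inv_mul_le_iff₀ (by positivity)]
    refine hl.trans ?_
    gcongr
    exact (le_max_right _ _).trans (le_max_right _ _)
  · refine hu.trans (mul_le_mul_of_nonneg_right ?_ (hf n))
    exact (le_max_left _ _).trans (le_max_right _ _)
end

section
/- Let K be a field, V a K-vector space, f : V →ₗ[K] V a linear endomorphism, ι an index type, and W : ι → Submodule K V a family of submodules such that each W i is f-invariant (f maps W i into W i) and the family forms an internal direct sum decomposition of V (DirectSum.IsInternal W). If μ ∈ K is an eigenvalue of f whose eigenspace E = ker(f − μ • id) has finrank K E = 1, then there exists an index i with E ≤ W i. (This is the step in the proof of Proposition 2.1 showing that the attracting eigenline of a proximal element lies in one of the irreducible summands of a semisimple representation.) -/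
/-- If a linear map preserves every summand of an internal direct sum and kills a vector, then it
kills all components of that vector. -/
theorem DirectSum.IsInternal.map_component_eq_zero {R M ι : Type*} [Ring R] [AddCommGroup M]
    [Module R M] [DecidableEq ι] {W : ι → Submodule R M} (hint : DirectSum.IsInternal W)
    {g : M →ₗ[R] M} (hg : ∀ i, ∀ v ∈ W i, g v ∈ W i) {x : DirectSum ι fun i => W i}
    (hx : g (DirectSum.coeLinearMap W x) = 0) (i : ι) : g (x i) = 0 := by
  have hcomm : DirectSum.coeLinearMap W ∘ₗ DirectSum.lmap (fun i => g.restrict (hg i)) =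
      g ∘ₗ DirectSum.coeLinearMap W := by
    ext j w
    simp
  have hzero : DirectSum.lmap (fun i => g.restrict (hg i)) x = 0 := by
    refine hint.injective ?_
    change DirectSum.coeLinearMap W _ = DirectSum.coeLinearMap W 0
    rw [map_zero, ← hx]
    exact LinearMap.congr_fun hcomm x
  exact congrArg Subtype.val (DFunLike.congr_fun hzero i)


/-- If `V` decomposes as an internal direct sum of `f`-invariant submodules
`W i` and `μ` is an eigenvalue of `f` whose eigenspace is one-dimensional,
then the eigenspace is contained in one of the summands `W i`. -/
theorem stmt5 (K : Type*) [Field K] (V : Type*) [AddCommGroup V] [Module K V]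
    (f : V →ₗ[K] V) (ι : Type*) [DecidableEq ι] (W : ι → Submodule K V)
    (hinv : ∀ i, ∀ v ∈ W i, f v ∈ W i)
    (hint : DirectSum.IsInternal W)
    (μ : K) (heig : Module.End.HasEigenvalue f μ)
    (hdim : Module.finrank K (LinearMap.ker (f - μ • LinearMap.id)) = 1) :
    ∃ i, LinearMap.ker (f - μ • LinearMap.id) ≤ W i := by
  have hg : ∀ i, ∀ v ∈ W i, (f - μ • LinearMap.id : V →ₗ[K] V) v ∈ W i := fun i v hv =>
    (W i).sub_mem (hinv i v hv) ((W i).smul_mem μ hv)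
  obtain ⟨v, hv, -⟩ := finrank_eq_one_iff'.mp hdim
  obtain ⟨x, hx⟩ := hint.surjective (v : V)
  change DirectSum.coeLinearMap W x = v at hx
  have hx0 : x ≠ 0 := by
    rintro rfl
    exact hv (Subtype.ext (by rw [← hx, map_zero]; rfl))
  obtain ⟨i, hi⟩ := DFunLike.ne_iff.mp hx0
  have hker : (f - μ • LinearMap.id : V →ₗ[K] V) (x i) = 0 :=
    hint.map_component_eq_zero hg (by rw [hx]; exact v.2) i
  refine ⟨i, fun w hw => ?_⟩
  have hne : (⟨x i, hker⟩ : LinearMap.ker (f - μ • LinearMap.id)) ≠ 0 := by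
    intro h
    have hval : (x i : V) = 0 := Submodule.mk_eq_zero (LinearMap.ker _) hker |>.mp h
    exact hi (Subtype.ext hval)
  obtain ⟨c, hc⟩ := (finrank_eq_one_iff_of_nonzero' _ hne).mp hdim ⟨w, hw⟩
  rw [show w = c • (x i : V) from (congrArg Subtype.val hc).symm]
  exact (W i).smul_mem c (x i).2
end
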